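/- Consider a phase of the algorithm TC. If TC applies a changeset X at time t, then X is not the disjoint union of two nonempty valid changesets; consequently, X is a tree cap of a tree of the subforest C_{t+1} if X is positive, and X is a tree cap of a tree of the subforest C_t if X is negative. -/

import Mathlib

open scoped Classical

/-!
Common setup for the online tree caching problem
(Bienkowski, Marcinkowski, Pacut, Schmid, Spyra, "Online Tree Caching").
-/

/-- A finite rooted tree on the vertex type `V`: every vertex has a parent,
the root is its own parent, and iterating `parent` from any vertex reaches the root. -/
structure RTree (V : Type) where
  root : V
  parent : V → V
  parent_root : parent root = root
  reaches_root : ∀ v : V, ∃ n : ℕ, parent^[n] v = root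

namespace RTree

variable {V : Type}

/-- The subtree `T(u)`: `u` together with all its descendants. -/
def subtree (T : RTree V) (u : V) : Set V :=
  {v | ∃ n : ℕ, T.parent^[n] v = u}

/-- `C` is a subforest of `T`: with every node it contains the whole subtree below it. -/
def Subforest (T : RTree V) (C : Set V) : Prop :=
  ∀ v ∈ C, T.subtree v ⊆ C

/-- `A` is a tree cap rooted at `v`: `A ⊆ T(v)`, `v ∈ A`, and `A` is closed under
taking the parent (towards `v`). -/
def TreeCap (T : RTree V) (v : V) (A : Set V) : Prop :=
  A ⊆ T.subtree v ∧ v ∈ A ∧ ∀ u ∈ A, u ≠ v → T.parent u ∈ A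

/-- `X` is a valid positive changeset for the cache `C`. -/
def ValidPos (T : RTree V) (C X : Set V) : Prop :=
  X.Nonempty ∧ X ∩ C = ∅ ∧ T.Subforest (C ∪ X)

/-- `X` is a valid negative changeset for the cache `C`. -/
def ValidNeg (T : RTree V) (C X : Set V) : Prop :=
  X.Nonempty ∧ X ⊆ C ∧ T.Subforest (C \ X)

/-- `X` is a valid changeset for the cache `C`. -/
def Valid (T : RTree V) (C X : Set V) : Prop :=
  T.ValidPos C X ∨ T.ValidNeg C X

/-- `w` is the root of a tree (connected component) of the subforest `C`. -/
def IsCompRoot (T : RTree V) (C : Set V) (w : V) : Prop :=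
  w ∈ C ∧ (w = T.root ∨ T.parent w ∉ C)

/-- The depth of a node: its distance to the root. -/
noncomputable def depth [DecidableEq V] (T : RTree V) (v : V) : ℕ :=
  Nat.find (T.reaches_root v)

/-- The height `h(T)` of the tree: its number of levels. -/
noncomputable def height [Fintype V] [DecidableEq V] (T : RTree V) : ℕ :=
  (Finset.univ.sup fun v => T.depth v) + 1

end RTree

/-- A request: a node together with a sign (`true` = positive, `false` = negative). -/
abbrev Request (V : Type) := V × Bool

/-- The request `r` incurs cost `1` when the cache is `C`
(a positive request to a non-cached node, or a negative request to a cached node). -/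
def Costly {V : Type} (r : Request V) (C : Set V) : Prop :=
  (r.2 = true ∧ r.1 ∉ C) ∨ (r.2 = false ∧ r.1 ∈ C)

/-- The sum of the counters `f` over the set of nodes `A`. -/
noncomputable def cntSum {V : Type} [Fintype V] (f : V → ℕ) (A : Set V) : ℕ :=
  ∑ v : V, A.indicator f v

/-- The number of nodes of a changeset (`0` for no changeset). -/
noncomputable def chgSize {V : Type} : Option (Set V) → ℕ
  | none => 0
  | some X => X.ncard

/-- One phase of the algorithm `TC` on the request sequence `req` (the request of
round `t ≥ 1` is `req t`), starting at time `0` with an empty cache.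
`cache t` is the cache contents during round `t`; `cnt t` are the counter values just
after serving the request of round `t` (used for the decision at time `t`);
`chg t` is the changeset applied at time `t` (right after round `t`), if any. -/
structure TCPhase {V : Type} [Fintype V] [DecidableEq V]
    (T : RTree V) (α : ℕ) (req : ℕ → Request V) where
  cache : ℕ → Set V
  cnt : ℕ → V → ℕ
  chg : ℕ → Option (Set V)
  cache_subforest : ∀ t, T.Subforest (cache t)
  cache_zero : cache 0 = ∅
  cnt_zero : ∀ v, cnt 0 v = 0
  cnt_rec : ∀ t v, cnt (t + 1) v =
    (if ∃ X, chg t = some X ∧ v ∈ X then 0 else cnt t v)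
    + (if (req (t + 1)).1 = v ∧ Costly (req (t + 1)) (cache (t + 1)) then 1 else 0)
  step_some : ∀ t X, chg t = some X →
    T.Valid (cache t) X ∧
    X.ncard * α ≤ cntSum (cnt t) X ∧
    (∀ Y, T.Valid (cache t) Y → X ⊂ Y → cntSum (cnt t) Y < Y.ncard * α) ∧
    cache (t + 1) = if T.ValidPos (cache t) X then cache t ∪ X else cache t \ X
  step_none : ∀ t, chg t = none →
    cache (t + 1) = cache t ∧
    ∀ X, T.Valid (cache t) X → cntSum (cnt t) X < X.ncard * α

namespace TCPhase

variable {V : Type} [Fintype V] [DecidableEq V]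
  {T : RTree V} {α : ℕ} {req : ℕ → Request V}

/-- The counter values at time `t`, right after the cache change at time `t`
(counters of fetched/evicted nodes are reset to `0`). -/
noncomputable def cntPost (E : TCPhase T α req) (t : ℕ) (v : V) : ℕ :=
  if ∃ X, E.chg t = some X ∧ v ∈ X then 0 else E.cnt t v

/-- `last_v(t)`: the last time strictly before `t` at which `v` changed its
cached/non-cached state (`0`, the beginning of the phase, if there is none). -/
noncomputable def lastChg (E : TCPhase T α req) (v : V) (t : ℕ) : ℕ :=
  ((Finset.range t).filter fun s => ¬ ((v ∈ E.cache s) ↔ v ∈ E.cache (s + 1))).sup id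

/-- The slot `(v, r)` belongs to the field `F^t`. -/
def inField (E : TCPhase T α req) (t : ℕ) (v : V) (r : ℕ) : Prop :=
  ∃ X, E.chg t = some X ∧ v ∈ X ∧ E.lastChg v t < r ∧ r ≤ t

/-- The number of requests of the sequence `ρ` lying in slots of `F^t_{≤ τ} ∩ D`. -/
noncomputable def fieldReqIn (E : TCPhase T α req) (ρ : ℕ → Request V)
    (t : ℕ) (D : Set V) (τ : ℕ) : ℕ :=
  ((Finset.Icc 1 t).filter fun r => r ≤ τ ∧ (ρ r).1 ∈ D ∧ E.inField t (ρ r).1 r).card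

/-- `req(F^t)`: the number of requests of `ρ` in slots of the field `F^t`. -/
noncomputable def fieldReq (E : TCPhase T α req) (ρ : ℕ → Request V) (t : ℕ) : ℕ :=
  E.fieldReqIn ρ t Set.univ t

/-- `size(F^t_{≤ τ} ∩ D)`: the number of distinct nodes having a slot in `F^t_{≤ τ} ∩ D`. -/
noncomputable def fieldSizeIn (E : TCPhase T α req) (t : ℕ) (D : Set V) (τ : ℕ) : ℕ :=
  (Finset.univ.filter fun v : V => v ∈ D ∧ ∃ r, r ≤ τ ∧ E.inField t v r).card

/-- The standing assumption: no positive requests are given to cached nodes and no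
negative requests to non-cached ones (so every request incurs cost `1` for `TC`). -/
def GoodReq (E : TCPhase T α req) : Prop :=
  ∀ t, 1 ≤ t →
    ((req t).2 = true → (req t).1 ∉ E.cache t) ∧
    ((req t).2 = false → (req t).1 ∈ E.cache t)

/-- The phase consists of rounds `1, …, tEnd`: no cache of `TC` before time `tEnd`
exceeds the capacity `kONL` (at time `tEnd` the triggered fetch, if any, is performed
even if it exceeds the capacity, and is followed by the final eviction). -/
def PhaseEnd (E : TCPhase T α req) (kONL tEnd : ℕ) : Prop :=
  ∀ t, t < tEnd → (E.cache (t + 1)).ncard ≤ kONL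

/-- `k_P`: the number of nodes in `TC`'s cache at the end of the phase
(after the fetch at time `tEnd`, before the final eviction). -/
noncomputable def kP (E : TCPhase T α req) (tEnd : ℕ) : ℕ :=
  (E.cache (tEnd + 1)).ncard

/-- The phase ending at `tEnd` is finished: the fetch at time `tEnd` exceeded the
capacity `kONL`. -/
def FinishedAt (E : TCPhase T α req) (kONL tEnd : ℕ) : Prop :=
  E.PhaseEnd kONL tEnd ∧ kONL < E.kP tEnd

/-- `size(𝓕)`: the total size of all fields of the phase. -/
noncomputable def sizeFields (E : TCPhase T α req) (tEnd : ℕ) : ℕ :=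
  ∑ t ∈ Finset.Icc 1 tEnd, chgSize (E.chg t)

/-- `req(F^∞)`: the number of requests of the phase lying in slots of the open field
(slots covered by no field of the phase). -/
noncomputable def openReq (E : TCPhase T α req) (tEnd : ℕ) : ℕ :=
  ((Finset.Icc 1 tEnd).filter fun r => ∀ t, t ≤ tEnd → ¬ E.inField t (req r).1 r).card

/-- `TC(P)`: the total cost paid by `TC` during the phase: serving the requests,
fetching/evicting the applied changesets (`α` per node), and the final eviction
(`α · k_P`) if the phase is finished. -/
noncomputable def tcCost (E : TCPhase T α req) (kONL tEnd : ℕ) : ℕ :=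
  ((Finset.Icc 1 tEnd).filter fun r => Costly (req r) (E.cache r)).card
  + α * E.sizeFields tEnd
  + (if kONL < E.kP tEnd then α * E.kP tEnd else 0)

/-- The tree cap `Y` (rooted at `u`, inside the negative field `F^t`) is proper for
the request sequence `ρ`: it holds `req(F^t ∩ Y) = |Y| · α`, and `F^t_{≤ τ} ∩ D` is
not over-requested for every tree cap `D ⊆ Y` rooted at `u` and every time `τ ≤ t`. -/
def Proper (E : TCPhase T α req) (ρ : ℕ → Request V) (t : ℕ) (u : V) (Y : Set V) : Prop :=
  E.fieldReqIn ρ t Y t = Y.ncard * α ∧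
  ∀ (D : Set V) (τ : ℕ), T.TreeCap u D → D ⊆ Y → τ ≤ t →
    E.fieldReqIn ρ t D τ ≤ E.fieldSizeIn t D τ * α

end TCPhase

/-- `D` is a feasible cache schedule for an (offline) algorithm with cache size `k`:
at every time the cache is a subforest of `T` of at most `k` nodes. -/
def IsSchedule {V : Type} (T : RTree V) (k : ℕ) (D : ℕ → Set V) : Prop :=
  ∀ t, T.Subforest (D t) ∧ (D t).ncard ≤ k

/-- The cost of serving the requests of rounds `a, …, b` of `ρ` when the cache during
round `r` is `D r`. -/
noncomputable def serveCost {V : Type} (ρ : ℕ → Request V) (D : ℕ → Set V) (a b : ℕ) : ℕ :=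
  ((Finset.Icc a b).filter fun r => Costly (ρ r) (D r)).card

/-- The reorganization cost of the schedule `D` (`α` per fetched or evicted node) over
the times `a, …, b - 1` (the change at time `t` leads from `D t` to `D (t+1)`). -/
noncomputable def moveCost {V : Type} (α : ℕ) (D : ℕ → Set V) (a b : ℕ) : ℕ :=
  α * ∑ t ∈ Finset.Ico a b, ((D (t + 1) \ D t).ncard + (D t \ D (t + 1)).ncard)

/-- `OPT`: the minimum cost of serving rounds `a, …, b` of `ρ` by an offline algorithm
with cache size `k` that may start with an arbitrary cache. -/
noncomputable def optCostFrom {V : Type} (T : RTree V) (α k : ℕ)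
    (ρ : ℕ → Request V) (a b : ℕ) : ℕ :=
  sInf {n | ∃ D : ℕ → Set V, IsSchedule T k D ∧
    n = serveCost ρ D a b + moveCost α D a b}

/-- `OPT`: the minimum cost of serving rounds `1, …, b` of `ρ` by an offline algorithm
with cache size `k` that starts with the empty cache. -/
noncomputable def optCostEmpty {V : Type} (T : RTree V) (α k : ℕ)
    (ρ : ℕ → Request V) (b : ℕ) : ℕ :=
  sInf {n | ∃ D : ℕ → Set V, IsSchedule T k D ∧ D 0 = ∅ ∧
    n = serveCost ρ D 1 b + moveCost α D 0 b}

/-- `ρ'` is obtained from `ρ` by legally shifting requests: signs are preserved, every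
positive request is moved to a descendant of its node (or kept), and every negative
request is moved to an ancestor of its node (or kept). -/
def LegalShift {V : Type} (T : RTree V) (ρ ρ' : ℕ → Request V) : Prop :=
  ∀ t, (ρ' t).2 = (ρ t).2 ∧
    ((ρ t).2 = true → (ρ' t).1 ∈ T.subtree (ρ t).1) ∧
    ((ρ t).2 = false → (ρ t).1 ∈ T.subtree (ρ' t).1)

/-- A full run of the algorithm `TC` with cache capacity `kONL` on the request
sequence `req`, including phase restarts: whenever the fetch of a saturated changeset
would exceed the capacity, `TC` instead evicts its whole cache and a new phase starts
(`newPhase t` holds, and all counters are reset). -/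
structure TCRun {V : Type} [Fintype V] [DecidableEq V]
    (T : RTree V) (α kONL : ℕ) (req : ℕ → Request V) where
  cache : ℕ → Set V
  cnt : ℕ → V → ℕ
  chg : ℕ → Option (Set V)
  newPhase : ℕ → Prop
  cache_subforest : ∀ t, T.Subforest (cache t)
  cache_zero : cache 0 = ∅
  cnt_zero : ∀ v, cnt 0 v = 0
  capacity : ∀ t, (cache t).ncard ≤ kONL
  cnt_rec : ∀ t v, cnt (t + 1) v =
    (if newPhase t ∨ ∃ X, chg t = some X ∧ v ∈ X then 0 else cnt t v)
    + (if (req (t + 1)).1 = v ∧ Costly (req (t + 1)) (cache (t + 1)) then 1 else 0)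
  step_some : ∀ t X, chg t = some X →
    T.Valid (cache t) X ∧
    X.ncard * α ≤ cntSum (cnt t) X ∧
    (∀ Y, T.Valid (cache t) Y → X ⊂ Y → cntSum (cnt t) Y < Y.ncard * α) ∧
    ((T.ValidPos (cache t) X ∧ (cache t ∪ X).ncard ≤ kONL ∧
        cache (t + 1) = cache t ∪ X ∧ ¬ newPhase t) ∨
     (T.ValidPos (cache t) X ∧ kONL < (cache t ∪ X).ncard ∧
        cache (t + 1) = ∅ ∧ newPhase t) ∨
     (T.ValidNeg (cache t) X ∧ cache (t + 1) = cache t \ X ∧ ¬ newPhase t))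
  step_none : ∀ t, chg t = none →
    cache (t + 1) = cache t ∧ ¬ newPhase t ∧
    ∀ X, T.Valid (cache t) X → cntSum (cnt t) X < X.ncard * α

/-- `TC(I)`: the total cost paid by the run `E` of `TC` on the rounds `1, …, N`:
serving the requests, plus `α` per fetched/evicted node (on a phase restart the whole
cache is evicted). -/
noncomputable def TCRun.cost {V : Type} [Fintype V] [DecidableEq V]
    {T : RTree V} {α kONL : ℕ} {req : ℕ → Request V}
    (E : TCRun T α kONL req) (N : ℕ) : ℕ :=
  ((Finset.Icc 1 N).filter fun r => Costly (req r) (E.cache r)).card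
  + α * ∑ t ∈ Finset.Icc 1 N,
      (if E.newPhase t then (E.cache t).ncard else chgSize (E.chg t))

namespace RTree

variable {V : Type} {T : RTree V} {C X Y : Set V} {u v w : V}

theorem mem_subtree_self (T : RTree V) (v : V) : v ∈ T.subtree v := ⟨0, rfl⟩

theorem mem_subtree_trans (huv : u ∈ T.subtree v) (hvw : v ∈ T.subtree w) : u ∈ T.subtree w := by
  obtain ⟨n, rfl⟩ := huv
  obtain ⟨m, rfl⟩ := hvw
  exact ⟨m + n, Function.iterate_add_apply ..⟩

theorem mem_subtree_parent (T : RTree V) (v : V) : v ∈ T.subtree (T.parent v) := ⟨1, rfl⟩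

theorem parent_mem_subtree (huv : u ∈ T.subtree v) (hne : u ≠ v) : T.parent u ∈ T.subtree v := by
  obtain ⟨n, rfl⟩ := huv
  cases n with
  | zero => exact absurd rfl hne
  | succ n => exact ⟨n, rfl⟩

/-- Two nodes with a common descendant are comparable. -/
theorem mem_subtree_or_mem_subtree (huv : u ∈ T.subtree v) (huw : u ∈ T.subtree w) :
    v ∈ T.subtree w ∨ w ∈ T.subtree v := by
  obtain ⟨n, rfl⟩ := huv
  obtain ⟨m, rfl⟩ := huw
  rcases le_total n m with h | h
  · exact .inl ⟨m - n, by rw [← Function.iterate_add_apply, Nat.sub_add_cancel h]⟩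
  · exact .inr ⟨n - m, by rw [← Function.iterate_add_apply, Nat.sub_add_cancel h]⟩

/-- A node of a subforest that has a descendant in the tree rooted at the component root `w`
itself belongs to this tree. -/
theorem IsCompRoot.mem_subtree (hC : T.Subforest C) (hw : T.IsCompRoot C w) (hv : v ∈ C)
    (huv : u ∈ T.subtree v) (huw : u ∈ T.subtree w) : v ∈ T.subtree w := by
  rcases mem_subtree_or_mem_subtree huv huw with h | h
  · exact h
  · by_cases hne : w = v
    · exact hne ▸ T.mem_subtree_self w
    · rcases hw.2 with rfl | hp
      · exact T.reaches_root v
      · exact absurd (hC v hv (parent_mem_subtree h hne)) hp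

/-- Every node of `C` lies below a component root of `C`. -/
theorem exists_isCompRoot (hv : v ∈ C) : ∃ w, T.IsCompRoot C w ∧ v ∈ T.subtree w := by
  obtain ⟨n, hn⟩ := T.reaches_root v
  induction n generalizing v with
  | zero => exact ⟨v, ⟨hv, .inl hn⟩, T.mem_subtree_self v⟩
  | succ n ih =>
    by_cases hp : T.parent v ∈ C
    · obtain ⟨w, hw, hvw⟩ := ih hp hn
      exact ⟨w, hw, mem_subtree_trans (T.mem_subtree_parent v) hvw⟩
    · exact ⟨v, ⟨hv, .inr hp⟩, T.mem_subtree_self v⟩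

theorem Subforest.inter (hX : T.Subforest X) (hY : T.Subforest Y) : T.Subforest (X ∩ Y) :=
  fun v hv => Set.subset_inter (hX v hv.1) (hY v hv.2)

theorem Subforest.union (hX : T.Subforest X) (hY : T.Subforest Y) : T.Subforest (X ∪ Y) := by
  rintro v (hv | hv)
  · exact (hX v hv).trans Set.subset_union_left
  · exact (hY v hv).trans Set.subset_union_right

theorem Valid.nonempty (h : T.Valid C X) : X.Nonempty := h.elim (·.1) (·.1)

theorem ValidNeg.not_validPos (h : T.ValidNeg C X) : ¬ T.ValidPos C X := by
  rintro ⟨⟨x, hx⟩, hXC, -⟩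
  exact Set.notMem_empty x (hXC ▸ ⟨hx, h.2.1 hx⟩)

/-- A positive changeset that does not split into two valid changesets is a tree cap. -/
theorem ValidPos.exists_treeCap (hC : T.Subforest C) (hX : T.ValidPos C X)
    (hsplit : ¬ ∃ X₁ X₂ : Set V, T.Valid C X₁ ∧ T.Valid C X₂ ∧ X₁ ∩ X₂ = ∅ ∧ X = X₁ ∪ X₂) :
    ∃ w, T.IsCompRoot (C ∪ X) w ∧ T.TreeCap w X := by
  obtain ⟨⟨x, hx⟩, hXC, hCX⟩ := hX
  have notMem : ∀ y ∈ X, y ∉ C := fun y hy hyC => Set.notMem_empty y (hXC ▸ ⟨hy, hyC⟩)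
  obtain ⟨w, hw, hxw⟩ := exists_isCompRoot (T := T) (C := C ∪ X) (.inr hx)
  have hwX : w ∈ X := hw.1.resolve_left fun h => notMem x hx (hC w h hxw)
  have hsub : X ⊆ T.subtree w := by
    by_contra hsub
    obtain ⟨y, hy, hyw⟩ := Set.not_subset.mp hsub
    refine hsplit ⟨X ∩ T.subtree w, X \ T.subtree w, .inl ⟨⟨x, hx, hxw⟩, ?_, ?_⟩,
      .inl ⟨⟨y, hy, hyw⟩, ?_, ?_⟩, ?_, (Set.inter_union_sdiff X _).symm⟩
    · grind
    · rintro v (hv | hv) u hu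
      · exact .inl (hC v hv hu)
      · exact (hCX v (.inr hv.1) hu).imp_right fun h => ⟨h, mem_subtree_trans hu hv.2⟩
    · grind
    · rintro v (hv | hv) u hu
      · exact .inl (hC v hv hu)
      · exact (hCX v (.inr hv.1) hu).imp_right fun h =>
          ⟨h, fun huw => hv.2 (hw.mem_subtree hCX (.inr hv.1) hu huw)⟩
    · grind
  refine ⟨w, hw, hsub, hwX, fun u hu hne => ?_⟩
  exact (hCX w hw.1 (parent_mem_subtree (hsub hu) hne)).resolve_left
    fun h => notMem u hu (hC _ h (T.mem_subtree_parent u))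

/-- A negative changeset that does not split into two valid changesets is a tree cap. -/
theorem ValidNeg.exists_treeCap (hC : T.Subforest C) (hX : T.ValidNeg C X)
    (hsplit : ¬ ∃ X₁ X₂ : Set V, T.Valid C X₁ ∧ T.Valid C X₂ ∧ X₁ ∩ X₂ = ∅ ∧ X = X₁ ∪ X₂) :
    ∃ w, T.IsCompRoot C w ∧ T.TreeCap w X := by
  obtain ⟨⟨x, hx⟩, hXC, hCX⟩ := hX
  have mem_of_mem_subtree : ∀ v ∈ C, ∀ u ∈ X, u ∈ T.subtree v → v ∈ X := fun v hv u hu huv => by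
    by_contra hvX
    exact (hCX v ⟨hv, hvX⟩ huv).2 hu
  obtain ⟨w, hw, hxw⟩ := exists_isCompRoot (T := T) (hXC hx)
  have hwX : w ∈ X := mem_of_mem_subtree w hw.1 x hx hxw
  have hsub : X ⊆ T.subtree w := by
    by_contra hsub
    obtain ⟨y, hy, hyw⟩ := Set.not_subset.mp hsub
    refine hsplit ⟨X ∩ T.subtree w, X \ T.subtree w,
      .inr ⟨⟨x, hx, hxw⟩, Set.inter_subset_left.trans hXC, fun v hv u hu => ?_⟩,
      .inr ⟨⟨y, hy, hyw⟩, Set.sdiff_subset.trans hXC, fun v hv u hu => ?_⟩,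
      by grind, (Set.inter_union_sdiff X _).symm⟩
    · exact ⟨hC v hv.1 hu, fun h => hv.2
        ⟨mem_of_mem_subtree v hv.1 u h.1 hu, hw.mem_subtree hC hv.1 hu h.2⟩⟩
    · exact ⟨hC v hv.1 hu, fun h => hv.2
        ⟨mem_of_mem_subtree v hv.1 u h.1 hu, fun hvw => h.2 (mem_subtree_trans hu hvw)⟩⟩
  exact ⟨w, hw, hsub, hwX, fun u hu hne => mem_of_mem_subtree _
    (hC w hw.1 (parent_mem_subtree (hsub hu) hne)) u hu (T.mem_subtree_parent u)⟩

/-- A changeset that is valid after applying `X` either extends `X` to a larger changeset of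
the same sign, or its part outside of `X` is empty or already was a valid changeset. -/
theorem Valid.union_or_diff (hC : T.Subforest C) (hX : T.Valid C X)
    (hY : T.Valid (if T.ValidPos C X then C ∪ X else C \ X) Y) :
    (T.Valid C (X ∪ Y) ∧ Disjoint X Y) ∨ Y \ X = ∅ ∨ T.Valid C (Y \ X) := by
  rcases hX with hX | hX
  · rw [if_pos hX] at hY
    have hXC : ∀ v ∈ X, v ∉ C := fun v hv hvC => Set.notMem_empty v (hX.2.1 ▸ ⟨hv, hvC⟩)
    rcases hY with ⟨hne, hYC, hsub⟩ | ⟨hne, hYC, hsub⟩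
    · refine .inl ⟨.inl ⟨hne.inr, by grind, Set.union_assoc C X Y ▸ hsub⟩, ?_⟩
      rw [Set.disjoint_iff_inter_eq_empty]
      grind
    · refine .inr ((Y \ X).eq_empty_or_nonempty.imp_right fun h => .inr ⟨h, by grind, ?_⟩)
      convert hC.inter hsub using 1
      grind
  · rw [if_neg hX.not_validPos] at hY
    have hXC := hX.2.1
    rcases hY with ⟨hne, hYC, hsub⟩ | ⟨hne, hYC, hsub⟩
    · refine .inr ((Y \ X).eq_empty_or_nonempty.imp_right fun h => .inl ⟨h, by grind, ?_⟩)
      convert hC.union hsub using 1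
      grind
    · refine .inl ⟨.inr ⟨hne.inr, by grind, by rwa [← Set.sdiff_sdiff]⟩, ?_⟩
      rw [Set.disjoint_iff_inter_eq_empty]
      grind

end RTree

section cntSum

variable {V : Type} [Fintype V] {f g : V → ℕ} {A B : Set V}

theorem cntSum_union (hAB : Disjoint A B) : cntSum f (A ∪ B) = cntSum f A + cntSum f B := by
  simp only [cntSum, Set.indicator_union_of_disjoint hAB, Finset.sum_add_distrib]

theorem cntSum_mono (hAB : ∀ v ∈ A, f v ≤ g v ∧ (f v ≠ 0 → v ∈ B)) :
    cntSum f A ≤ cntSum g B := by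
  refine Finset.sum_le_sum fun v _ => ?_
  by_cases hA : v ∈ A
  · by_cases hB : v ∈ B
    · simpa [hA, hB] using (hAB v hA).1
    · simpa [hA, hB] using mt (hAB v hA).2 hB
  · simp [hA]

theorem cntSum_add (f g : V → ℕ) (A : Set V) :
    cntSum (fun v => f v + g v) A = cntSum f A + cntSum g A := by
  simp only [cntSum, Set.indicator_add, Finset.sum_add_distrib]

end cntSum

namespace TCPhase

variable {V : Type} [Fintype V] [DecidableEq V] {T : RTree V} {α : ℕ} {req : ℕ → Request V}

/-- Each round adds at most one request to the counters of a set of nodes. -/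
theorem cntSum_cnt_succ_le (E : TCPhase T α req) (t : ℕ) (A : Set V) :
    cntSum (E.cnt (t + 1)) A ≤ cntSum (E.cntPost t) A + 1 := by
  have heq : E.cnt (t + 1) = fun v => E.cntPost t v +
      (if (req (t + 1)).1 = v ∧ Costly (req (t + 1)) (E.cache (t + 1)) then 1 else 0) :=
    funext fun v => E.cnt_rec t v
  rw [heq, cntSum_add]
  refine Nat.add_le_add_left ?_ _
  calc _ ≤ ∑ v : V, if (req (t + 1)).1 = v then 1 else 0 := by
        refine Finset.sum_le_sum fun v _ => ?_
        by_cases hv : v ∈ A <;> by_cases hr : (req (t + 1)).1 = v <;> simp [hv, hr]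
        split_ifs <;> simp
    _ ≤ 1 := by simp

/-- If no valid changeset is saturated after the cache change at time `t`, then no two disjoint
valid changesets have enough requests in total to be both saturated at time `t + 1`. -/
theorem cntSum_add_lt_of_cntPost (E : TCPhase T α req) {t : ℕ}
    (hpost : ∀ Y, T.Valid (E.cache (t + 1)) Y → cntSum (E.cntPost t) Y < Y.ncard * α)
    {A B : Set V} (hA : T.Valid (E.cache (t + 1)) A) (hB : T.Valid (E.cache (t + 1)) B)
    (hAB : Disjoint A B) :
    cntSum (E.cnt (t + 1)) A + cntSum (E.cnt (t + 1)) B < A.ncard * α + B.ncard * α := by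
  have h := E.cntSum_cnt_succ_le t (A ∪ B)
  rw [cntSum_union hAB, cntSum_union hAB] at h
  have := hpost A hA
  have := hpost B hB
  omega

/-- If no two disjoint valid changesets have enough requests in total to be both saturated at
time `t`, then no valid changeset is saturated after the cache change at time `t`. -/
theorem cntSum_cntPost_lt_of_add_lt (E : TCPhase T α req) (hα : 1 ≤ α) {t : ℕ}
    (hdisj : ∀ A B, T.Valid (E.cache t) A → T.Valid (E.cache t) B → Disjoint A B →
      cntSum (E.cnt t) A + cntSum (E.cnt t) B < A.ncard * α + B.ncard * α)
    {Y : Set V} (hY : T.Valid (E.cache (t + 1)) Y) :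
    cntSum (E.cntPost t) Y < Y.ncard * α := by
  have hYpos : 0 < Y.ncard * α := Nat.mul_pos ((Set.ncard_pos Y.toFinite).mpr hY.nonempty) hα
  cases hchg : E.chg t with
  | none =>
    obtain ⟨hcache, hunsat⟩ := E.step_none t hchg
    have heq : E.cntPost t = E.cnt t := funext fun v => by simp [cntPost, hchg]
    exact heq ▸ hunsat Y (hcache ▸ hY)
  | some X =>
    obtain ⟨hX, hsat, hmax, hcache⟩ := E.step_some t X hchg
    have hpost : ∀ v, E.cntPost t v = if v ∈ X then 0 else E.cnt t v := fun v => by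
      simp [cntPost, hchg]
    have hle : cntSum (E.cntPost t) Y ≤ cntSum (E.cnt t) (Y \ X) :=
      cntSum_mono fun v hv => by
        rw [hpost]
        split_ifs with hvX <;> simp [hv, hvX]
    rw [hcache] at hY
    rcases hX.union_or_diff (E.cache_subforest t) hY with ⟨hXY, hdis⟩ | hempty | hdiff
    · have hss : X ⊂ X ∪ Y := by
        refine Set.ssubset_iff_subset_ne.mpr ⟨Set.subset_union_left, fun h => ?_⟩
        obtain ⟨y, hy⟩ := hY.nonempty
        exact hdis.notMem_of_mem_right hy (h ▸ .inr hy)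
      have hlt := hmax _ hXY hss
      rw [cntSum_union hdis, Set.ncard_union_eq hdis, add_mul] at hlt
      rw [hdis.symm.sdiff_eq_left] at hle
      omega
    · refine hle.trans_lt ?_
      simpa [hempty, cntSum] using hYpos
    · have hlt := hdisj X _ hX hdiff Set.disjoint_sdiff_right
      have hcard : (Y \ X).ncard * α ≤ Y.ncard * α :=
        Nat.mul_le_mul_right α (Set.ncard_le_ncard Set.sdiff_subset)
      omega

/-- At no time do two disjoint valid changesets have enough requests in total to be both
saturated. -/
theorem cntSum_add_lt (E : TCPhase T α req) (hα : 1 ≤ α) (t : ℕ) {A B : Set V}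
    (hA : T.Valid (E.cache t) A) (hB : T.Valid (E.cache t) B) (hAB : Disjoint A B) :
    cntSum (E.cnt t) A + cntSum (E.cnt t) B < A.ncard * α + B.ncard * α := by
  induction t generalizing A B with
  | zero =>
    have hpos : 0 < A.ncard * α := Nat.mul_pos ((Set.ncard_pos A.toFinite).mpr hA.nonempty) hα
    simp only [cntSum, Set.indicator, E.cnt_zero, ite_self, Finset.sum_const_zero]
    omega
  | succ t ih =>
    exact E.cntSum_add_lt_of_cntPost
      (fun Y hY => E.cntSum_cntPost_lt_of_add_lt hα (fun _ _ => ih) hY) hA hB hAB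

end TCPhase

/-- a changeset `X` applied by `TC` at time `t` is not the disjoint union
of two nonempty valid changesets; consequently `X` is a tree cap of a tree of the
subforest `C_{t+1}` if `X` is positive, and of a tree of `C_t` if `X` is negative. -/
theorem tc_applied_changeset_is_tree_cap {V : Type} [Fintype V] [DecidableEq V]
    {T : RTree V} {α : ℕ} {req : ℕ → Request V}
    (E : TCPhase T α req) (hα : 1 ≤ α) (t : ℕ) (ht : 1 ≤ t)
    (X : Set V) (hchg : E.chg t = some X) :
    (¬ ∃ X₁ X₂ : Set V, T.Valid (E.cache t) X₁ ∧ T.Valid (E.cache t) X₂ ∧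
        X₁ ∩ X₂ = ∅ ∧ X = X₁ ∪ X₂) ∧
    (T.ValidPos (E.cache t) X →
      ∃ w, T.IsCompRoot (E.cache (t + 1)) w ∧ T.TreeCap w X ∧ X ⊆ E.cache (t + 1)) ∧
    (T.ValidNeg (E.cache t) X →
      ∃ w, T.IsCompRoot (E.cache t) w ∧ T.TreeCap w X ∧ X ⊆ E.cache t) := by
  obtain ⟨-, hsat, -, hcache⟩ := E.step_some t X hchg
  have hsplit : ¬ ∃ X₁ X₂ : Set V, T.Valid (E.cache t) X₁ ∧ T.Valid (E.cache t) X₂ ∧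
      X₁ ∩ X₂ = ∅ ∧ X = X₁ ∪ X₂ := by
    rintro ⟨X₁, X₂, h₁, h₂, hdis, rfl⟩
    have hdis := Set.disjoint_iff_inter_eq_empty.mpr hdis
    have hlt := E.cntSum_add_lt hα t h₁ h₂ hdis
    rw [cntSum_union hdis, Set.ncard_union_eq hdis, add_mul] at hsat
    exact absurd hsat hlt.not_ge
  refine ⟨hsplit, fun hX => ?_, fun hX => ?_⟩
  · rw [hcache, if_pos hX]
    obtain ⟨w, hw, hcap⟩ := hX.exists_treeCap (E.cache_subforest t) hsplit
    exact ⟨w, hw, hcap, Set.subset_union_right⟩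
  · obtain ⟨w, hw, hcap⟩ := hX.exists_treeCap (E.cache_subforest t) hsplit
    exact ⟨w, hw, hcap, hX.2.1⟩
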